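/- Let −1 ≤ α ≤ 1. Then N(g_α) = 0 for α ≠ −1, and N(g_{−1}) = 2; equivalently, the maximal rank over x ∈ ℝ^8 of the matrix A_α(x) equals 8 for α ≠ −1 and equals 6 for α = −1. -/

import Mathlib

/-- The underlying space `ℝ⁸` of the family `g_α`. -/
abbrev V8 : Type := Fin 8 → ℝ

/-- The standard basis vector `X_{k+1}` (0-indexed: `e8 k`). -/
def e8 (k : Fin 8) : V8 := fun l => if l = k then 1 else 0

/-- Brackets of basis elements of `g_α` for `i < j` (0-indexed, `X_{i+1} = e8 i`):
`u α i j = [X_{i+1}, X_{j+1}]`. -/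
noncomputable def gUpper (α : ℝ) : Fin 8 → Fin 8 → V8 := fun i j =>
  match (i : ℕ), (j : ℕ) with
  | 0, 1 => (2 : ℝ) • e8 1          -- [X₁,X₂] = 2X₂
  | 0, 2 => (-2 : ℝ) • e8 2         -- [X₁,X₃] = −2X₃
  | 1, 2 => e8 0                    -- [X₂,X₃] = X₁
  | 0, 3 => e8 3                    -- [X₁,X₄] = X₄
  | 0, 4 => -e8 4                   -- [X₁,X₅] = −X₅
  | 0, 5 => e8 5                    -- [X₁,X₆] = X₆
  | 0, 6 => -e8 6                   -- [X₁,X₇] = −X₇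
  | 1, 4 => e8 3                    -- [X₂,X₅] = X₄
  | 1, 6 => e8 5                    -- [X₂,X₇] = X₆
  | 2, 3 => e8 4                    -- [X₃,X₄] = X₅
  | 2, 5 => e8 6                    -- [X₃,X₆] = X₇
  | 3, 7 => e8 3                    -- [X₄,X₈] = X₄
  | 4, 7 => e8 4                    -- [X₅,X₈] = X₅
  | 5, 7 => α • e8 5                -- [X₆,X₈] = αX₆
  | 6, 7 => α • e8 6                -- [X₇,X₈] = αX₇
  | _, _ => 0

/-- The structure constants `C_{ij}^k` of `g_α`. -/
noncomputable def gC (α : ℝ) (i j k : Fin 8) : ℝ := gUpper α i j k - gUpper α j i k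

/-- The bilinear map on `ℝ⁸` with structure constants `C`. -/
noncomputable def brOf (C : Fin 8 → Fin 8 → Fin 8 → ℝ) : V8 →ₗ[ℝ] V8 →ₗ[ℝ] V8 :=
  LinearMap.mk₂ ℝ (fun x y k => ∑ i, ∑ j, C i j k * x i * y j)
    (by
      intro x x' y
      funext k
      simp only [Pi.add_apply]
      rw [← Finset.sum_add_distrib]
      refine Finset.sum_congr rfl fun i _ => ?_
      rw [← Finset.sum_add_distrib]
      exact Finset.sum_congr rfl fun j _ => by ring)
    (by
      intro c x y
      funext k
      simp only [Pi.smul_apply, smul_eq_mul]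
      rw [Finset.mul_sum]
      refine Finset.sum_congr rfl fun i _ => ?_
      rw [Finset.mul_sum]
      exact Finset.sum_congr rfl fun j _ => by ring)
    (by
      intro x y y'
      funext k
      simp only [Pi.add_apply]
      rw [← Finset.sum_add_distrib]
      refine Finset.sum_congr rfl fun i _ => ?_
      rw [← Finset.sum_add_distrib]
      exact Finset.sum_congr rfl fun j _ => by ring)
    (by
      intro c x y
      funext k
      simp only [Pi.smul_apply, smul_eq_mul]
      rw [Finset.mul_sum]
      refine Finset.sum_congr rfl fun i _ => ?_
      rw [Finset.mul_sum]
      exact Finset.sum_congr rfl fun j _ => by ring)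

/-- The Lie bracket `μ_α` of the Lie algebra `g_α`, as a bilinear map on `ℝ⁸`. -/
noncomputable def brA (α : ℝ) : V8 →ₗ[ℝ] V8 →ₗ[ℝ] V8 := brOf (gC α)

/-- The matrix `A_α(x)` with `(i,j)` entry `Σ_k C_{ij}^k x_k`. -/
noncomputable def Amat (α : ℝ) (x : V8) : Matrix (Fin 8) (Fin 8) ℝ :=
  Matrix.of fun i j => ∑ k, gC α i j k * x k

/-- The maximal rank of `A_α(x)` over `x ∈ ℝ⁸`. -/
noncomputable def maxRank (α : ℝ) : ℕ := sSup (Set.range fun x : V8 => (Amat α x).rank)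

/-- The number of invariants of the coadjoint representation of `g_α`. -/
noncomputable def NInv (α : ℝ) : ℕ := 8 - maxRank α

theorem Matrix.rank_add_two_le_of_mulVec_eq_zero {K : Type*} [Field K] {m n : ℕ}
    (A : Matrix (Fin m) (Fin n) K) (v w : Fin n → K) (hv : A.mulVec v = 0) (hw : A.mulVec w = 0)
    (h : LinearIndependent K ![v, w]) : A.rank + 2 ≤ n := by
  have hker : Submodule.span K (Set.range ![v, w]) ≤ LinearMap.ker A.mulVecLin := by
    rw [Submodule.span_le]
    rintro _ ⟨i, rfl⟩
    fin_cases i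
    · exact hv
    · exact hw
  have h2 := Submodule.finrank_mono hker
  rw [finrank_span_eq_card h, Fintype.card_fin] at h2
  have hrn := A.mulVecLin.finrank_range_add_finrank_ker
  rw [Module.finrank_fin_fun] at hrn
  rw [Matrix.rank]
  omega

theorem e8_dotProduct (k : Fin 8) (x : V8) : e8 k ⬝ᵥ x = x k := by
  simp [e8, dotProduct]

theorem Amat_apply (α : ℝ) (x : V8) (i j : Fin 8) :
    Amat α x i j = gUpper α i j ⬝ᵥ x - gUpper α j i ⬝ᵥ x := by
  rw [← sub_dotProduct]
  rfl

theorem gUpper_eq (α : ℝ) : gUpper α =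
    ![![0, (2 : ℝ) • e8 1, (-2 : ℝ) • e8 2, e8 3, -e8 4, e8 5, -e8 6, 0],
      ![0, 0, e8 0, 0, e8 3, 0, e8 5, 0],
      ![0, 0, 0, e8 4, 0, e8 6, 0, 0],
      ![0, 0, 0, 0, 0, 0, 0, e8 3],
      ![0, 0, 0, 0, 0, 0, 0, e8 4],
      ![0, 0, 0, 0, 0, 0, 0, α • e8 5],
      ![0, 0, 0, 0, 0, 0, 0, α • e8 6],
      0] := by
  funext i j
  fin_cases i <;> fin_cases j <;> rfl

theorem Amat_eq (α : ℝ) (x : V8) : Amat α x =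
    !![0, 2 * x 1, -2 * x 2, x 3, -x 4, x 5, -x 6, 0;
      -2 * x 1, 0, x 0, 0, x 3, 0, x 5, 0;
      2 * x 2, -x 0, 0, x 4, 0, x 6, 0, 0;
      -x 3, 0, -x 4, 0, 0, 0, 0, x 3;
      x 4, -x 3, 0, 0, 0, 0, 0, x 4;
      -x 5, 0, -x 6, 0, 0, 0, 0, α * x 5;
      x 6, -x 5, 0, 0, 0, 0, 0, α * x 6;
      0, 0, 0, -x 3, -x 4, -(α * x 5), -(α * x 6), 0] := by
  ext i j
  rw [Amat_apply, gUpper_eq]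
  fin_cases i <;> fin_cases j <;> simp [e8_dotProduct]

theorem Amat_mulVec (α : ℝ) (x v : V8) : (Amat α x).mulVec v =
    ![2 * x 1 * v 1 - 2 * x 2 * v 2 + x 3 * v 3 - x 4 * v 4 + x 5 * v 5 - x 6 * v 6,
      -2 * x 1 * v 0 + x 0 * v 2 + x 3 * v 4 + x 5 * v 6,
      2 * x 2 * v 0 - x 0 * v 1 + x 4 * v 3 + x 6 * v 5,
      -x 3 * v 0 - x 4 * v 2 + x 3 * v 7,
      x 4 * v 0 - x 3 * v 1 + x 4 * v 7,
      -x 5 * v 0 - x 6 * v 2 + α * x 5 * v 7,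
      x 6 * v 0 - x 5 * v 1 + α * x 6 * v 7,
      -x 3 * v 3 - x 4 * v 4 - α * x 5 * v 5 - α * x 6 * v 6] := by
  rw [Amat_eq]
  ext i
  fin_cases i <;> simp [Matrix.mulVec, dotProduct, Fin.sum_univ_eight] <;> ring

theorem rank_Amat_eq_eight {α : ℝ} (hα : α ≠ -1) :
    (Amat α ![0, 0, 0, 1, 0, 0, 1, 0]).rank = 8 := by
  have hinj : Function.Injective (Amat α ![0, 0, 0, 1, 0, 0, 1, 0]).mulVecLin := by
    rw [← LinearMap.ker_eq_bot, LinearMap.ker_eq_bot']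
    intro v hv
    rw [Matrix.mulVecLin_apply, Amat_mulVec] at hv
    have hc := fun i => congrFun hv i
    simp [Fin.forall_fin_succ] at hc
    obtain ⟨h0, h1, h2, h3, h4, h5, h6, h7⟩ := hc
    have hv7 : v 7 = 0 := by
      have : (1 + α) * v 7 = 0 := by linarith
      exact (mul_eq_zero.mp this).resolve_left fun h => hα (by linarith)
    have hv0 : v 0 = 0 := by rw [hv7] at h3; linarith
    have hv6 : v 6 = 0 := by
      have : (1 + α) * v 6 = 0 := by linear_combination -h0 - h7
      exact (mul_eq_zero.mp this).resolve_left fun h => hα (by linarith)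
    have hv3 : v 3 = 0 := by rw [hv6] at h0; linarith
    funext i
    fin_cases i <;> simp <;> linarith
  rw [Matrix.rank, LinearMap.finrank_range_of_inj hinj, Module.finrank_fin_fun]

/-- The two kernel vectors used when both `(x₄, x₅)` and `(x₆, x₇)` are nonzero are the gradients
of the invariants `x₄x₇ - x₅x₆` and
`x₁(x₄x₇ + x₅x₆) + 2x₂x₅x₇ - 2x₃x₄x₆ + x₈(x₄x₇ - x₅x₆)`. -/
theorem rank_Amat_neg_one_le (x : V8) : (Amat (-1) x).rank ≤ 6 := by
  suffices ∃ v w : V8, (Amat (-1) x).mulVec v = 0 ∧ (Amat (-1) x).mulVec w = 0 ∧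
      LinearIndependent ℝ ![v, w] by
    obtain ⟨v, w, hv, hw, h⟩ := this
    have := Matrix.rank_add_two_le_of_mulVec_eq_zero _ v w hv hw h
    omega
  by_cases hp : x 3 = 0 ∧ x 4 = 0
  · refine ⟨![0, 0, 0, 1, 0, 0, 0, 0], ![0, 0, 0, 0, 1, 0, 0, 0], ?_, ?_, ?_⟩
    · rw [Amat_mulVec]
      ext i; fin_cases i <;> simp [hp.1, hp.2]
    · rw [Amat_mulVec]
      ext i; fin_cases i <;> simp [hp.1, hp.2]
    · rw [LinearIndependent.pair_iff]
      intro s t h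
      have h3 := congrFun h 3
      have h4 := congrFun h 4
      simp at h3 h4
      exact ⟨h3, h4⟩
  by_cases hq : x 5 = 0 ∧ x 6 = 0
  · refine ⟨![0, 0, 0, 0, 0, 1, 0, 0], ![0, 0, 0, 0, 0, 0, 1, 0], ?_, ?_, ?_⟩
    · rw [Amat_mulVec]
      ext i; fin_cases i <;> simp [hq.1, hq.2]
    · rw [Amat_mulVec]
      ext i; fin_cases i <;> simp [hq.1, hq.2]
    · rw [LinearIndependent.pair_iff]
      intro s t h
      have h5 := congrFun h 5
      have h6 := congrFun h 6
      simp at h5 h6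
      exact ⟨h5, h6⟩
  refine ⟨![0, 0, 0, x 6, -x 5, -x 4, x 3, 0],
    ![x 3 * x 6 + x 4 * x 5, 2 * x 4 * x 6, -2 * x 3 * x 5,
      x 0 * x 6 - 2 * x 2 * x 5 + x 7 * x 6, x 0 * x 5 + 2 * x 1 * x 6 - x 7 * x 5,
      x 0 * x 4 - 2 * x 2 * x 3 - x 7 * x 4, x 0 * x 3 + 2 * x 1 * x 4 + x 7 * x 3,
      x 3 * x 6 - x 4 * x 5], ?_, ?_, ?_⟩
  · rw [Amat_mulVec]
    ext i; fin_cases i <;> simp <;> ring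
  · rw [Amat_mulVec]
    ext i; fin_cases i <;> simp <;> ring
  · rw [LinearIndependent.pair_iff]
    intro s t h
    have h0 := congrFun h 0
    have h1 := congrFun h 1
    have h2 := congrFun h 2
    have h3 := congrFun h 3
    have h4 := congrFun h 4
    have h5 := congrFun h 5
    have h6 := congrFun h 6
    have h7 := congrFun h 7
    simp at h0 h1 h2 h3 h4 h5 h6 h7
    have ht : t = 0 := by
      by_contra ht
      simp only [ht, false_or] at h0 h1 h2 h7
      have h36 : x 3 * x 6 = 0 := by linarith
      have h45 : x 4 * x 5 = 0 := by linarith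
      simp only [mul_eq_zero] at h36 h45
      tauto
    subst ht
    refine ⟨?_, rfl⟩
    by_contra hs
    simp [hs] at h3 h4
    exact hq ⟨h4, h3⟩

theorem six_le_rank_Amat_neg_one : 6 ≤ (Amat (-1) ![0, 0, 0, 1, 0, 0, 1, 0]).rank := by
  set A := Amat (-1) ![0, 0, 0, 1, 0, 0, 1, 0] with hA
  have hker : Module.finrank ℝ (LinearMap.ker A.mulVecLin) ≤ 2 := by
    let f : LinearMap.ker A.mulVecLin →ₗ[ℝ] (Fin 2 → ℝ) :=
      (LinearMap.funLeft ℝ ℝ ![(3 : Fin 8), 7]).comp (LinearMap.ker A.mulVecLin).subtype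
    have hf : Function.Injective f := by
      rw [← LinearMap.ker_eq_bot, LinearMap.ker_eq_bot']
      rintro ⟨v, hv⟩ hfv
      have hv3 : v 3 = 0 := congrFun hfv 0
      have hv7 : v 7 = 0 := congrFun hfv 1
      rw [LinearMap.mem_ker, Matrix.mulVecLin_apply, hA, Amat_mulVec] at hv
      have hc := fun i => congrFun hv i
      simp [Fin.forall_fin_succ] at hc
      obtain ⟨h0, h1, h2, h3, h4, h5, h6, h7⟩ := hc
      ext i
      fin_cases i <;> simp <;> linarith
    simpa using LinearMap.finrank_le_finrank_of_injective hf
  have hrn := A.mulVecLin.finrank_range_add_finrank_ker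
  rw [Module.finrank_fin_fun] at hrn
  rw [Matrix.rank]
  omega

theorem maxRank_eq_of_le {α : ℝ} {r : ℕ} (x : V8) (hx : r ≤ (Amat α x).rank)
    (h : ∀ y, (Amat α y).rank ≤ r) : maxRank α = r := by
  refine IsGreatest.csSup_eq ⟨⟨x, le_antisymm (h x) hx⟩, ?_⟩
  rintro _ ⟨y, rfl⟩
  exact h y

/-- `N(g_α) = 0` for `α ≠ −1` and `N(g_{−1}) = 2`; equivalently the maximal rank of
`A_α(x)` is `8` for `α ≠ −1` and `6` for `α = −1`. -/
theorem number_of_invariants_of_family (α : ℝ) (hα : α ∈ Set.Icc (-1 : ℝ) 1) :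
    (α ≠ -1 → NInv α = 0 ∧ maxRank α = 8) ∧ (α = -1 → NInv α = 2 ∧ maxRank α = 6) := by
  constructor
  · intro h
    have hr : maxRank α = 8 :=
      maxRank_eq_of_le _ (rank_Amat_eq_eight h).ge fun y => (Amat α y).rank_le_width
    exact ⟨by rw [NInv, hr], hr⟩
  · rintro rfl
    have hr : maxRank (-1) = 6 := maxRank_eq_of_le _ six_le_rank_Amat_neg_one rank_Amat_neg_one_le
    exact ⟨by rw [NInv, hr], hr⟩
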